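/- arXiv:math/0506085 — 2 statements merged into one kernel-verified Lean document; each statement's English description precedes it below -/
import Mathlib

section
/- Let L = Q(G; A, B, C, D) with A(g,h) = gh, B(g,h) = gh, C(g,h) = h*g, D(g,h) = g0·g·h* (the construction of de Barros and Juriaans). Then the following are equivalent: (i) L is associative; (ii) L is a Moufang loop, i.e. satisfies x∘(y∘(x∘z)) = ((x∘y)∘x)∘z for all x, y, z ∈ L; (iii) G is commutative. -/
open Function

/-- Multiplication on the disjoint union `G ⊕ G` (first summand: `G`, second: `Gu`)
determined by four maps `A B C D : G → G → G`. -/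
def Qmul {G : Type*} (A B C D : G → G → G) : G ⊕ G → G ⊕ G → G ⊕ G
  | Sum.inl g, Sum.inl h => Sum.inl (A g h)
  | Sum.inl g, Sum.inr h => Sum.inr (B g h)
  | Sum.inr g, Sum.inl h => Sum.inr (C g h)
  | Sum.inr g, Sum.inr h => Sum.inl (D g h)

/-- A magma is a loop with identity `e` if `e` is a two-sided identity and all
left and right translations are bijections. -/
def IsLoopWith {α : Type*} (mul : α → α → α) (e : α) : Prop :=
  (∀ x, mul e x = x) ∧ (∀ x, mul x e = x) ∧
  (∀ a, Function.Bijective fun x => mul a x) ∧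
  (∀ a, Function.Bijective fun x => mul x a)

/-- The eight basic maps `G × G → G` built from `*` (here written `s`). -/
def IsBasic {G : Type*} [Group G] (s : G → G) (ε : G → G → G) : Prop :=
  ε = (fun g h => g * h) ∨ ε = (fun g h => g * s h) ∨
  ε = (fun g h => s g * h) ∨ ε = (fun g h => s g * s h) ∨
  ε = (fun g h => h * g) ∨ ε = (fun g h => h * s g) ∨
  ε = (fun g h => s h * g) ∨ ε = (fun g h => s h * s g)

/-- A map of the form `(g,h) ↦ g0 ^ m * ε (g,h)` for a basic map `ε`. -/
def IsG0Form {G : Type*} [Group G] (s : G → G) (g0 : G) (X : G → G → G) : Prop :=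
  ∃ (m : ℤ) (ε : G → G → G), IsBasic s ε ∧ X = fun g h => g0 ^ m * ε g h

/-- If `g * s g` is central, then `g` and `s g` commute. -/
theorem commute_of_mul_mem_center {G : Type*} [Group G] {s : G → G}
    (hcen : ∀ g, g * s g ∈ Subgroup.center G) (g : G) : s g * g = g * s g := by
  have h := Subgroup.mem_center_iff.mp (hcen g) g
  rw [mul_assoc] at h
  exact (mul_left_cancel h).symm

theorem statement_9 {G : Type*} [Group G] (s : G → G) (g0 : G)
    (hinv : ∀ g, s (s g) = g)
    (hanti : ∀ g h, s (g * h) = s h * s g)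
    (hcen : ∀ g, g * s g ∈ Subgroup.center G)
    (hg0 : g0 ∈ Subgroup.center G) (hg0s : s g0 = g0)
    (mul : G ⊕ G → G ⊕ G → G ⊕ G)
    (hmul : mul = Qmul (fun g h => g * h) (fun g h => g * h)
      (fun g h => s h * g) (fun g h => g0 * g * s h)) :
    ((∀ x y z, mul (mul x y) z = mul x (mul y z)) ↔
      (∀ x y z, mul x (mul y (mul x z)) = mul (mul (mul x y) x) z)) ∧
    ((∀ x y z, mul x (mul y (mul x z)) = mul (mul (mul x y) x) z) ↔
      (∀ a b : G, a * b = b * a)) := by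
  have assoc_moufang (h : ∀ x y z, mul (mul x y) z = mul x (mul y z)) (x y z : G ⊕ G) :
      mul x (mul y (mul x z)) = mul (mul (mul x y) x) z := by
    rw [h, h]
  have moufang_comm (h : ∀ x y z, mul x (mul y (mul x z)) = mul (mul (mul x y) x) z)
      (a b : G) : a * b = b * a := by
    have key := h (Sum.inl a) (Sum.inr 1) (Sum.inl (s b))
    simp only [hmul, Qmul, hanti, hinv, mul_one, Sum.inr.injEq,
      commute_of_mul_mem_center hcen a] at key
    rw [← mul_assoc, ← mul_assoc] at key
    exact mul_right_cancel key
  have comm_assoc (h : ∀ a b : G, a * b = b * a) (x y z : G ⊕ G) :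
      mul (mul x y) z = mul x (mul y z) := by
    have hc (a b c : G) : a * (b * c) = b * (a * c) := by
      rw [← mul_assoc, h a b, mul_assoc]
    rcases x with x | x <;> rcases y with y | y <;> rcases z with z | z <;>
      simp only [hmul, Qmul, hanti, hinv, hg0s, h, hc]
  exact ⟨⟨assoc_moufang, fun h => comm_assoc (moufang_comm h)⟩,
    ⟨moufang_comm, fun h => assoc_moufang (comm_assoc h)⟩⟩
end

section
/- Assume * is not the identity map, A(g,h) = gh, B equals (as a map G × G → G) one of (g,h) ↦ gh, g*h, hg, hg*, C equals one of (g,h) ↦ gh, hg, and D equals (g,h) ↦ g0·ε(g,h) for one of the eight basic maps ε. Then the loop L = Q(G; A, B, C, D) is a C-loop, i.e. satisfies x∘(y∘(y∘z)) = ((x∘y)∘y)∘z for all x, y, z ∈ L, if and only if L is an extra loop (satisfies x∘(y∘(z∘x)) = ((x∘y)∘z)∘x) or [g² ∈ Z(G) for every g ∈ G and (B, C, D) equals, as maps, one of ((g,h)↦hg, (g,h)↦hg, (g,h)↦g0·hg) and ((g,h)↦h·g*, (g,h)↦gh, (g,h)↦g0·g*·h)]. -/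
open Function

section

variable {G : Type*} [Group G] {s : G → G} {g0 : G} {B C D : G → G → G}

/-- The identity `x(y(yz)) = ((xy)y)z` defining C-loops. -/
def IsCMul {α : Type*} (mul : α → α → α) : Prop :=
  ∀ x y z, mul x (mul y (mul y z)) = mul (mul (mul x y) y) z

/-- The identity `x(y(zx)) = ((xy)z)x` defining extra loops. -/
def IsExtraMul {α : Type*} (mul : α → α → α) : Prop :=
  ∀ x y z, mul x (mul y (mul z x)) = mul (mul (mul x y) z) x

theorem map_one_of_anti (hanti : ∀ g h, s (g * h) = s h * s g) : s 1 = 1 := by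
  simpa using hanti 1 1

theorem mul_left_comm_of_central (hg0 : ∀ g, g * g0 = g0 * g) (a b : G) :
    a * (g0 * b) = g0 * (a * b) := by
  rw [← mul_assoc, hg0, mul_assoc]

theorem classify_of_unit_slices (hanti : ∀ g h, s (g * h) = s h * s g) (hne : s ≠ id)
    (hB : B = (fun g h => g * h) ∨ B = (fun g h => s g * h) ∨
          B = (fun g h => h * g) ∨ B = (fun g h => h * s g))
    (hD : ∃ ε : G → G → G, IsBasic s ε ∧ D = fun g h => g0 * ε g h)
    (h1 : ∀ k, D 1 k = g0 * k) (h2 : ∀ k, D k 1 = g0 * B k 1) :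
    ((B = (fun g h => g * h) ∨ B = (fun g h => h * g)) ∧
      (D = (fun g h => g0 * (g * h)) ∨ D = (fun g h => g0 * (h * g)))) ∨
    ((B = (fun g h => s g * h) ∨ B = (fun g h => h * s g)) ∧
      (D = (fun g h => g0 * (s g * h)) ∨ D = (fun g h => g0 * (h * s g)))) := by
  have s1 := map_one_of_anti hanti
  obtain ⟨k, hk⟩ : ∃ k, s k ≠ k := Function.ne_iff.mp hne
  obtain ⟨ε, hε, rfl⟩ := hD
  have h1k := h1 k
  have h2k := h2 k
  rcases hB with rfl | rfl | rfl | rfl <;>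
    rcases hε with rfl | rfl | rfl | rfl | rfl | rfl | rfl | rfl <;>
    simp [s1, hk, hk.symm] at h1k h2k ⊢

theorem unit_slices_of_isCMul (hanti : ∀ g h, s (g * h) = s h * s g)
    (hg0 : ∀ g, g * g0 = g0 * g)
    (hB : B = (fun g h => g * h) ∨ B = (fun g h => s g * h) ∨
          B = (fun g h => h * g) ∨ B = (fun g h => h * s g))
    (hC : C = (fun g h => g * h) ∨ C = (fun g h => h * g))
    (hD : ∃ ε : G → G → G, IsBasic s ε ∧ D = fun g h => g0 * ε g h)
    (H : IsCMul (Qmul (fun g h => g * h) B C D)) :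
    ∀ k, D 1 k = g0 * k ∧ D k 1 = g0 * B k 1 := by
  have s1 := map_one_of_anti hanti
  intro k
  have h1 := H (.inl 1) (.inr 1) (.inl k)
  have h2 := H (.inl k) (.inr 1) (.inl 1)
  obtain ⟨ε, hε, rfl⟩ := hD
  rcases hB with rfl | rfl | rfl | rfl <;>
    rcases hC with rfl | rfl <;>
    rcases hε with rfl | rfl | rfl | rfl | rfl | rfl | rfl | rfl <;>
    simp [Qmul, s1, hg0] at h1 h2 ⊢ <;> grind

theorem unit_slices_of_isExtraMul (hinv : ∀ g, s (s g) = g) (hanti : ∀ g h, s (g * h) = s h * s g)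
    (hg0 : ∀ g, g * g0 = g0 * g) (hg0s : s g0 = g0)
    (hB : B = (fun g h => g * h) ∨ B = (fun g h => s g * h) ∨
          B = (fun g h => h * g) ∨ B = (fun g h => h * s g))
    (hC : C = (fun g h => g * h) ∨ C = (fun g h => h * g))
    (hD : ∃ ε : G → G → G, IsBasic s ε ∧ D = fun g h => g0 * ε g h)
    (H : IsExtraMul (Qmul (fun g h => g * h) B C D)) :
    ∀ k, D 1 k = g0 * k ∧ D k 1 = g0 * B k 1 := by
  have s1 := map_one_of_anti hanti
  intro k
  have h1 := H (.inr 1) (.inr 1) (.inl k)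
  have h2 := H (.inr 1) (.inl 1) (.inl k)
  have h3 := H (.inr 1) (.inr 1) (.inl (s k))
  obtain ⟨ε, hε, rfl⟩ := hD
  rcases hB with rfl | rfl | rfl | rfl <;>
    rcases hC with rfl | rfl <;>
    rcases hε with rfl | rfl | rfl | rfl | rfl | rfl | rfl | rfl <;>
    simp [Qmul, s1, hg0, hg0s, hanti, hinv] at h1 h2 h3 ⊢ <;> grind

theorem isCMul_and_isExtraMul_of_comm (hanti : ∀ g h, s (g * h) = s h * s g) (hinv : ∀ g, s (s g) = g)
    (hg0s : s g0 = g0) (hcomm : ∀ g h : G, g * h = h * g)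
    (hC : C = (fun g h => g * h) ∨ C = (fun g h => h * g))
    (hBD : ((B = (fun g h => g * h) ∨ B = (fun g h => h * g)) ∧
      (D = (fun g h => g0 * (g * h)) ∨ D = (fun g h => g0 * (h * g)))) ∨
    ((B = (fun g h => s g * h) ∨ B = (fun g h => h * s g)) ∧
      (D = (fun g h => g0 * (s g * h)) ∨ D = (fun g h => g0 * (h * s g))))) :
    IsCMul (Qmul (fun g h => g * h) B C D) ∧ IsExtraMul (Qmul (fun g h => g * h) B C D) := by
  have hlc : ∀ a b c : G, a * (b * c) = b * (a * c) := fun a b c => by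
    rw [← mul_assoc, hcomm a b, mul_assoc]
  have hC' : C = fun g h => g * h := by
    rcases hC with rfl | rfl
    · rfl
    · funext g h; exact hcomm h g
  have hBD' : (B = (fun g h => g * h) ∧ D = (fun g h => g0 * (g * h))) ∨
      (B = (fun g h => s g * h) ∧ D = (fun g h => g0 * (s g * h))) := by
    refine hBD.imp ?_ ?_ <;> rintro ⟨rfl | rfl, rfl | rfl⟩ <;>
      constructor <;> funext g h <;> simp only [hcomm h]
  subst hC'
  constructor <;> rcases hBD' with ⟨rfl, rfl⟩ | ⟨rfl, rfl⟩ <;>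
    rintro (x | x) (y | y) (z | z) <;>
    simp [Qmul, hanti, hinv, hg0s, hcomm, hlc]

theorem isCMul_comm_or (hanti : ∀ g h, s (g * h) = s h * s g) (hinv : ∀ g, s (s g) = g)
    (hg0 : ∀ g, g * g0 = g0 * g)
    (hC : C = (fun g h => g * h) ∨ C = (fun g h => h * g))
    (hBD : ((B = (fun g h => g * h) ∨ B = (fun g h => h * g)) ∧
      (D = (fun g h => g0 * (g * h)) ∨ D = (fun g h => g0 * (h * g)))) ∨
    ((B = (fun g h => s g * h) ∨ B = (fun g h => h * s g)) ∧
      (D = (fun g h => g0 * (s g * h)) ∨ D = (fun g h => g0 * (h * s g)))))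
    (H : ∀ g h k, g * D h (C h k) = D (B g h) h * k) :
    (∀ g h : G, g * h = h * g) ∨
    (B = (fun g h => g * h) ∧ C = (fun g h => g * h) ∧ D = (fun g h => g0 * (g * h))) ∨
    (B = (fun g h => h * g) ∧ C = (fun g h => h * g) ∧ D = (fun g h => g0 * (h * g))) ∨
    (B = (fun g h => s g * h) ∧ C = (fun g h => h * g) ∧ D = (fun g h => g0 * (h * s g))) ∨
    (B = (fun g h => h * s g) ∧ C = (fun g h => g * h) ∧ D = (fun g h => g0 * (s g * h))) := by
  have s1 := map_one_of_anti hanti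
  have hl := mul_left_comm_of_central hg0
  rcases hC with rfl | rfl <;> rcases hBD with ⟨rfl | rfl, rfl | rfl⟩ | ⟨rfl | rfl, rfl | rfl⟩ <;>
    first
    | (left; intro g h
       have H1 := H g h 1
       have H2 := H 1 g h
       have H3 := H g (s h) 1
       have H4 := H 1 (s g) h
       have H5 := H g (s h) (s h)⁻¹
       have H6 := H g h h⁻¹
       simp [s1, hinv, hanti, hl, mul_assoc] at H1 H2 H3 H4 H5 H6
       clear H hanti hinv hg0 hl
       first
       | grind
       | exact mul_right_cancel (b := s h) (by simpa only [mul_assoc] using H1))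
    | simp

theorem isExtraMul_comm_or (hanti : ∀ g h, s (g * h) = s h * s g) (hinv : ∀ g, s (s g) = g)
    (hg0 : ∀ g, g * g0 = g0 * g) (hg0s : s g0 = g0)
    (hC : C = (fun g h => g * h) ∨ C = (fun g h => h * g))
    (hBD : ((B = (fun g h => g * h) ∨ B = (fun g h => h * g)) ∧
      (D = (fun g h => g0 * (g * h)) ∨ D = (fun g h => g0 * (h * g)))) ∨
    ((B = (fun g h => s g * h) ∨ B = (fun g h => h * s g)) ∧
      (D = (fun g h => g0 * (s g * h)) ∨ D = (fun g h => g0 * (h * s g)))))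
    (H : ∀ g h k, C g (D h (B k g)) = B (D g h * k) g) :
    (∀ g h : G, g * h = h * g) ∨
    (B = (fun g h => g * h) ∧ C = (fun g h => g * h) ∧ D = (fun g h => g0 * (g * h))) ∨
    (B = (fun g h => s g * h) ∧ C = (fun g h => h * g) ∧ D = (fun g h => g0 * (h * s g))) := by
  have s1 := map_one_of_anti hanti
  have hl := mul_left_comm_of_central hg0
  rcases hC with rfl | rfl <;> rcases hBD with ⟨rfl | rfl, rfl | rfl⟩ | ⟨rfl | rfl, rfl | rfl⟩ <;>
    first
    | simp; done
    | (left; intro g h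
       have H1 := H g h 1
       have H2 := H g 1 h
       have H3 := H g (s h) 1
       have H4 := H 1 (s g) (s h)
       have H5 := H g h g⁻¹
       have H6 := H g 1 (s h)
       simp [s1, hinv, hanti, hl, hg0, hg0s, mul_assoc] at H1 H2 H3 H4 H5 H6
       clear H hanti hinv hg0 hl hg0s
       first
       | grind
       | (simp only [← mul_assoc] at H1 H2 H3 H4 H5 H6
          simp at H1 H2 H3 H4 H5 H6
          grind))

theorem isCMul_and_isExtraMul_group (hg0 : ∀ g, g * g0 = g0 * g) :
    IsCMul (Qmul (fun g h => g * h) (fun g h => g * h) (fun g h => g * h)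
      (fun g h => g0 * (g * h))) ∧
    IsExtraMul (Qmul (fun g h => g * h) (fun g h => g * h) (fun g h => g * h)
      (fun g h => g0 * (g * h))) := by
  have hl := mul_left_comm_of_central hg0
  constructor <;> rintro (x | x) (y | y) (z | z) <;> simp [Qmul, hl, mul_assoc]

theorem isCMul_opposite (hsq : ∀ g h : G, g * (g * h) = h * (g * g)) (hg0 : ∀ g, g * g0 = g0 * g) :
    IsCMul (Qmul (fun g h => g * h) (fun g h => h * g) (fun g h => h * g)
      (fun g h => g0 * (h * g))) := by
  have hsq' : ∀ g h : G, g * (g * h) = h * g ^ 2 := fun g h => by rw [hsq, sq]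
  have hl := mul_left_comm_of_central hg0
  rintro (x | x) (y | y) (z | z) <;> simp [Qmul, hl, mul_assoc] <;>
    simp only [hsq', ← sq, mul_assoc]

theorem isCMul_twisted (hanti : ∀ g h, s (g * h) = s h * s g) (hinv : ∀ g, s (s g) = g)
    (hnorm : ∀ g h : G, g * (s g * h) = h * (g * s g))
    (hsq : ∀ g h : G, g * (g * h) = h * (g * g))
    (hg0 : ∀ g, g * g0 = g0 * g) (hg0s : s g0 = g0) :
    IsCMul (Qmul (fun g h => g * h) (fun g h => h * s g) (fun g h => g * h)
      (fun g h => g0 * (s g * h))) := by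
  have hsq' : ∀ g h : G, g * (g * h) = h * g ^ 2 := fun g h => by rw [hsq, sq]
  have hl := mul_left_comm_of_central hg0
  have hc : ∀ g, s g * g = g * s g := fun g => by simpa using hnorm g g
  have hnorm' : ∀ g h, s g * (g * h) = h * (g * s g) := fun g h => by
    rw [← hnorm, ← mul_assoc, hc, mul_assoc]
  rintro (x | x) (y | y) (z | z) <;>
    simp [Qmul, hl, hg0, hg0s, hinv, hanti, mul_assoc, hnorm, hnorm', hc] <;>
    simp only [hsq', ← sq, mul_assoc]

theorem isCMul_moufang (hanti : ∀ g h, s (g * h) = s h * s g) (hinv : ∀ g, s (s g) = g)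
    (hnorm : ∀ g h : G, g * (s g * h) = h * (g * s g))
    (hsq : ∀ g h : G, g * (g * h) = h * (g * g))
    (hg0 : ∀ g, g * g0 = g0 * g) (hg0s : s g0 = g0) :
    IsCMul (Qmul (fun g h => g * h) (fun g h => s g * h) (fun g h => h * g)
      (fun g h => g0 * (h * s g))) := by
  have hsq' : ∀ g h : G, g * (g * h) = h * g ^ 2 := fun g h => by rw [hsq, sq]
  have hl := mul_left_comm_of_central hg0
  have hc : ∀ g, s g * g = g * s g := fun g => by simpa using hnorm g g
  rintro (x | x) (y | y) (z | z) <;>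
    simp [Qmul, hl, hg0, hg0s, hinv, hanti, mul_assoc, hnorm, hc] <;>
    simp only [hsq', ← sq, mul_assoc]

theorem isExtraMul_moufang (hanti : ∀ g h, s (g * h) = s h * s g) (hinv : ∀ g, s (s g) = g)
    (hnorm : ∀ g h : G, g * (s g * h) = h * (g * s g))
    (hsq : ∀ g h : G, g * (g * h) = h * (g * g))
    (hg0 : ∀ g, g * g0 = g0 * g) (hg0s : s g0 = g0) :
    IsExtraMul (Qmul (fun g h => g * h) (fun g h => s g * h) (fun g h => h * g)
      (fun g h => g0 * (h * s g))) := by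
  have hsq' : ∀ g h : G, g * (g * h) = h * g ^ 2 := fun g h => by rw [hsq, sq]
  have hl := mul_left_comm_of_central hg0
  have hswap : ∀ g a b, s g * (a * (g * b)) = g * (a * (s g * b)) := fun g a b => by
    apply mul_left_cancel (a := g)
    rw [hnorm g, hsq g (a * (s g * b))]
    simp only [mul_assoc]
    rw [← hnorm g b, hsq g (s g * b)]
    simp only [mul_assoc]
  rintro (x | x) (y | y) (z | z) <;>
    simp [Qmul, hl, hg0, hg0s, hinv, hanti, mul_assoc, hnorm, hswap] <;>
    simp only [hsq', ← sq, mul_assoc]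

theorem mul_self_central_of_isCMul (hanti : ∀ g h, s (g * h) = s h * s g)
    (hinv : ∀ g, s (s g) = g) (H : IsCMul (Qmul (fun g h => g * h) B C D))
    (hBC : C = (fun g h => h * g) ∨ (B = (fun g h => h * s g) ∧ C = (fun g h => g * h) ∧
      D = (fun g h => g0 * (s g * h)))) :
    ∀ g h : G, g * (g * h) = h * (g * g) := by
  intro g h
  have s1 := map_one_of_anti hanti
  rcases hBC with rfl | ⟨rfl, rfl, rfl⟩
  · simpa [Qmul, mul_assoc] using H (.inr 1) (.inl g) (.inl h)
  · simpa [Qmul, s1, hanti, hinv, mul_assoc] using (H (.inr 1) (.inl (s g)) (.inr h)).symm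

theorem mul_self_central_of_isExtraMul (hanti : ∀ g h, s (g * h) = s h * s g)
    (hinv : ∀ g, s (s g) = g) (hnorm : ∀ g h : G, g * (s g * h) = h * (g * s g))
    (H : IsExtraMul (Qmul (fun g h => g * h) (fun g h => s g * h) (fun g h => h * g) D)) :
    ∀ g h : G, g * (g * h) = h * (g * g) := by
  intro g h
  have key : g * (h * s g) = s g * (h * g) := by
    simpa [Qmul, hanti, hinv, mul_assoc] using (H (.inl g) (.inl (s h)) (.inr 1)).symm
  have key' : g * (g * (h * s g)) = h * (g * (g * s g)) := by
    rw [key, hnorm, mul_assoc]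
  apply mul_right_cancel (b := s g)
  simpa only [mul_assoc] using key'

end

theorem statement_17 {G : Type*} [Group G] (s : G → G) (g0 : G)
    (hinv : ∀ g, s (s g) = g)
    (hanti : ∀ g h, s (g * h) = s h * s g)
    (hcen : ∀ g, g * s g ∈ Subgroup.center G)
    (hg0 : g0 ∈ Subgroup.center G) (hg0s : s g0 = g0)
    (hne : s ≠ id)
    (B C D : G → G → G)
    (hB : B = (fun g h => g * h) ∨ B = (fun g h => s g * h) ∨
          B = (fun g h => h * g) ∨ B = (fun g h => h * s g))
    (hC : C = (fun g h => g * h) ∨ C = (fun g h => h * g))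
    (hD : ∃ ε : G → G → G, IsBasic s ε ∧ D = fun g h => g0 * ε g h)
    (mul : G ⊕ G → G ⊕ G → G ⊕ G)
    (hmul : mul = Qmul (fun g h => g * h) B C D) :
    (∀ x y z, mul x (mul y (mul y z)) = mul (mul (mul x y) y) z) ↔
      ((∀ x y z, mul x (mul y (mul z x)) = mul (mul (mul x y) z) x) ∨
       ((∀ g : G, g ^ 2 ∈ Subgroup.center G) ∧
          ((B = (fun g h => h * g) ∧ C = (fun g h => h * g) ∧
              D = (fun g h => g0 * (h * g))) ∨
           (B = (fun g h => h * s g) ∧ C = (fun g h => g * h) ∧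
              D = (fun g h => g0 * (s g * h)))))) := by
  subst hmul
  have hg0' : ∀ g, g * g0 = g0 * g := fun g => Subgroup.mem_center_iff.mp hg0 g
  have hnorm : ∀ g h : G, g * (s g * h) = h * (g * s g) := fun g h => by
    rw [← mul_assoc, ← Subgroup.mem_center_iff.mp (hcen g) h]
  have hcenter : (∀ g : G, g ^ 2 ∈ Subgroup.center G) ↔ ∀ g h : G, g * (g * h) = h * (g * g) := by
    simp only [Subgroup.mem_center_iff, sq, mul_assoc, eq_comm]
  rw [hcenter]
  change IsCMul _ ↔ IsExtraMul _ ∨ _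
  constructor
  · intro H
    have hU := unit_slices_of_isCMul hanti hg0' hB hC hD H
    have hBD := classify_of_unit_slices hanti hne hB hD (fun k => (hU k).1) (fun k => (hU k).2)
    have hE : ∀ g h k, g * D h (C h k) = D (B g h) h * k := fun g h k => by
      simpa [Qmul] using H (.inl g) (.inr h) (.inl k)
    rcases isCMul_comm_or hanti hinv hg0' hC hBD hE with
      hcomm | ⟨rfl, rfl, rfl⟩ | ⟨rfl, rfl, rfl⟩ | ⟨rfl, rfl, rfl⟩ | ⟨rfl, rfl, rfl⟩
    · exact .inl (isCMul_and_isExtraMul_of_comm hanti hinv hg0s hcomm hC hBD).2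
    · exact .inl (isCMul_and_isExtraMul_group hg0').2
    · exact .inr ⟨mul_self_central_of_isCMul (g0 := g0) hanti hinv H (.inl rfl),
        .inl ⟨rfl, rfl, rfl⟩⟩
    · exact .inl (isExtraMul_moufang hanti hinv hnorm
        (mul_self_central_of_isCMul (g0 := g0) hanti hinv H (.inl rfl)) hg0' hg0s)
    · exact .inr ⟨mul_self_central_of_isCMul hanti hinv H (.inr ⟨rfl, rfl, rfl⟩),
        .inr ⟨rfl, rfl, rfl⟩⟩
  · rintro (H | ⟨hsq, ⟨rfl, rfl, rfl⟩ | ⟨rfl, rfl, rfl⟩⟩)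
    · have hU := unit_slices_of_isExtraMul hinv hanti hg0' hg0s hB hC hD H
      have hBD := classify_of_unit_slices hanti hne hB hD (fun k => (hU k).1) (fun k => (hU k).2)
      have hE : ∀ g h k, C g (D h (B k g)) = B (D g h * k) g := fun g h k => by
        simpa [Qmul] using H (.inr g) (.inr h) (.inl k)
      rcases isExtraMul_comm_or hanti hinv hg0' hg0s hC hBD hE with
        hcomm | ⟨rfl, rfl, rfl⟩ | ⟨rfl, rfl, rfl⟩
      · exact (isCMul_and_isExtraMul_of_comm hanti hinv hg0s hcomm hC hBD).1
      · exact (isCMul_and_isExtraMul_group hg0').1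
      · exact isCMul_moufang hanti hinv hnorm
          (mul_self_central_of_isExtraMul hanti hinv hnorm H) hg0' hg0s
    · exact isCMul_opposite hsq hg0'
    · exact isCMul_twisted hanti hinv hnorm hsq hg0' hg0s
end
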